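/- Let F be a field of characteristic 2, λ ∈ F nonzero, L = Lei₄(3,F), G = Aut(L), and C = C_G(L/ζ(L)) = {f ∈ G : f(x) − x ∈ ζ(L) for all x ∈ L}. Then the quotient group G/C is isomorphic to the subgroup of GL₂(F) consisting of all invertible matrices of the form [[α₁, λα₂],[α₂, α₁]] with α₁, α₂ ∈ F. -/

import Mathlib

/-- A (left) Leibniz algebra over a field `F`: a vector space with a bilinear
bracket satisfying the left Leibniz identity. -/
structure LeibnizAlg (F : Type*) [Field F] (L : Type*) [AddCommGroup L] [Module F L] where
  bracket : L →ₗ[F] L →ₗ[F] L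
  leibniz : ∀ a b c : L,
    bracket (bracket a b) c = bracket a (bracket b c) - bracket b (bracket a c)

namespace LeibnizAlg

variable {F : Type*} [Field F] {L : Type*} [AddCommGroup L] [Module F L]

/-- The left center `ζ^left(L)`. -/
def leftCenter (A : LeibnizAlg F L) : Submodule F L where
  carrier := {x | ∀ y : L, A.bracket x y = 0}
  add_mem' := by
    intro a b ha hb y
    simp [map_add, LinearMap.add_apply, ha y, hb y]
  zero_mem' := by intro y; simp
  smul_mem' := by
    intro c x hx y
    simp [map_smul, LinearMap.smul_apply, hx y]

/-- The right center `ζ^right(L)`. -/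
def rightCenter (A : LeibnizAlg F L) : Submodule F L where
  carrier := {x | ∀ y : L, A.bracket y x = 0}
  add_mem' := by
    intro a b ha hb y
    simp [ha y, hb y]
  zero_mem' := by intro y; simp
  smul_mem' := by
    intro c x hx y
    simp [hx y]

/-- The center `ζ(L)`. -/
def center (A : LeibnizAlg F L) : Submodule F L := A.leftCenter ⊓ A.rightCenter

/-- The derived subalgebra `[L,L]`. -/
def derived (A : LeibnizAlg F L) : Submodule F L :=
  Submodule.span F {z | ∃ a b : L, z = A.bracket a b}

/-- The Leibniz kernel `Leib(L)`, spanned by the squares `[a,a]`. -/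
def leibKernel (A : LeibnizAlg F L) : Submodule F L :=
  Submodule.span F {z | ∃ a : L, z = A.bracket a a}

/-- Upper central series: `upper 0 = ⊥ = ζ₀(L)`, `upper (n+1) = ζ_{n+1}(L)`. -/
def upper (A : LeibnizAlg F L) : ℕ → Submodule F L
  | 0 => ⊥
  | n + 1 =>
    { carrier := {x | ∀ y : L, A.bracket x y ∈ A.upper n ∧ A.bracket y x ∈ A.upper n}
      add_mem' := by
        intro a b ha hb y
        constructor
        · simpa [map_add, LinearMap.add_apply] using add_mem (ha y).1 (hb y).1
        · simpa [map_add] using add_mem (ha y).2 (hb y).2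
      zero_mem' := by
        intro y
        constructor <;> simp
      smul_mem' := by
        intro c x hx y
        constructor
        · simpa [map_smul, LinearMap.smul_apply] using Submodule.smul_mem _ c (hx y).1
        · simpa [map_smul] using Submodule.smul_mem _ c (hx y).2 }

/-- Lower central series: `lower 0 = ⊤ = γ₁(L)`, `lower n = γ_{n+1}(L)`. -/
def lower (A : LeibnizAlg F L) : ℕ → Submodule F L
  | 0 => ⊤
  | n + 1 => Submodule.span F {z | ∃ x a : L, a ∈ A.lower n ∧ z = A.bracket x a}

/-- The automorphism group of a Leibniz algebra, as a subgroup of the group of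
linear automorphisms of the underlying vector space. -/
def Aut (A : LeibnizAlg F L) : Subgroup (L ≃ₗ[F] L) where
  carrier := {f | ∀ a b : L, f (A.bracket a b) = A.bracket (f a) (f b)}
  mul_mem' := by
    intro f g hf hg a b
    show f (g (A.bracket a b)) = A.bracket (f (g a)) (f (g b))
    rw [hg, hf]
  one_mem' := by intro a b; rfl
  inv_mem' := by
    intro f hf a b
    apply f.injective
    show f (f.symm (A.bracket a b)) = f (A.bracket (f.symm a) (f.symm b))
    rw [hf, f.apply_symm_apply, f.apply_symm_apply, f.apply_symm_apply]

/-- The group `B(V,Φ)` of linear automorphisms of `V` preserving the bilinear form `Φ`. -/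
def formPreserving (F : Type*) [Field F] (V : Type*) [AddCommGroup V] [Module F V]
    (Φ : V →ₗ[F] V →ₗ[F] F) : Subgroup (V ≃ₗ[F] V) where
  carrier := {g | ∀ x y : V, Φ (g x) (g y) = Φ x y}
  mul_mem' := by
    intro f g hf hg x y
    show Φ (f (g x)) (f (g y)) = Φ x y
    rw [hf, hg]
  one_mem' := by intro x y; rfl
  inv_mem' := by
    intro f hf x y
    have h := hf (f.symm x) (f.symm y)
    rw [f.apply_symm_apply, f.apply_symm_apply] at h
    exact h.symm

/-- The subalgebra generated by an element `b`. -/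
def genBy (A : LeibnizAlg F L) (b : L) : Submodule F L :=
  sInf {S : Submodule F L | b ∈ S ∧ ∀ x ∈ S, ∀ y ∈ S, A.bracket x y ∈ S}

end LeibnizAlg

/-- The bilinear bracket of the algebra `Lei₄(3,F)`:
`[x,y] = (x₀y₀ + λ x₁y₁)·a₃` where `a₃ = (0,0,1)`. -/
def leiBracket (F : Type*) [Field F] (lam : F) :
    (Fin 3 → F) →ₗ[F] (Fin 3 → F) →ₗ[F] (Fin 3 → F) :=
  LinearMap.mk₂ F (fun x y => (x 0 * y 0 + lam * (x 1 * y 1)) • (![0, 0, 1] : Fin 3 → F))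
    (by
      intro x x' y
      rw [← add_smul]
      simp only [Pi.add_apply]
      ring_nf)
    (by
      intro c x y
      rw [smul_smul]
      simp only [Pi.smul_apply, smul_eq_mul]
      ring_nf)
    (by
      intro x y y'
      rw [← add_smul]
      simp only [Pi.add_apply]
      ring_nf)
    (by
      intro c x y
      rw [smul_smul]
      simp only [Pi.smul_apply, smul_eq_mul]
      ring_nf)

/-- The Leibniz algebra `Lei₄(3,F)` with parameter `λ`. -/
def lei4 (F : Type*) [Field F] (lam : F) : LeibnizAlg F (Fin 3 → F) where
  bracket := leiBracket F lam
  leibniz := by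
    intro a b c
    simp [leiBracket, LinearMap.mk₂_apply]

theorem lei4_bracket_apply (F : Type*) [Field F] (lam : F) (x y : Fin 3 → F) :
    (lei4 F lam).bracket x y = ![0, 0, x 0 * y 0 + lam * (x 1 * y 1)] := by
  ext i
  fin_cases i <;> simp [lei4, leiBracket]

theorem lei4_mem_center (F : Type*) [Field F] (lam : F) (hlam : lam ≠ 0) (x : Fin 3 → F) :
    x ∈ (lei4 F lam).center ↔ x 0 = 0 ∧ x 1 = 0 := by
  constructor
  · rintro ⟨h, -⟩
    have h0 := congrFun (h ![1, 0, 0]) 2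
    have h1 := congrFun (h ![0, 1, 0]) 2
    rw [lei4_bracket_apply] at h0 h1
    simp [hlam] at h0 h1
    exact ⟨h0, h1⟩
  · rintro ⟨h0, h1⟩
    constructor
    · intro y
      rw [lei4_bracket_apply]
      ext i
      fin_cases i <;> simp [h0, h1]
    · intro y
      rw [lei4_bracket_apply]
      ext i
      fin_cases i <;> simp [h0, h1]

/-- The matrix induced on `L/ζ(L)`. -/
def lei4Mat {F : Type*} [Field F] (f : (Fin 3 → F) ≃ₗ[F] (Fin 3 → F)) :
    Matrix (Fin 2) (Fin 2) F :=
  !![f ![1, 0, 0] 0, f ![0, 1, 0] 0; f ![1, 0, 0] 1, f ![0, 1, 0] 1]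

theorem lei4_e3 {F : Type*} [Field F] {lam : F} {f : (Fin 3 → F) ≃ₗ[F] (Fin 3 → F)}
    (hf : f ∈ (lei4 F lam).Aut) :
    f ![0, 0, 1] = ![0, 0, f ![1, 0, 0] 0 * f ![1, 0, 0] 0
      + lam * (f ![1, 0, 0] 1 * f ![1, 0, 0] 1)] := by
  have h := hf ![1, 0, 0] ![1, 0, 0]
  rw [lei4_bracket_apply, lei4_bracket_apply] at h
  simpa using h

theorem lei4_apply {F : Type*} [Field F] (f : (Fin 3 → F) ≃ₗ[F] (Fin 3 → F))
    (x : Fin 3 → F) :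
    f x = x 0 • f ![1, 0, 0] + x 1 • f ![0, 1, 0] + x 2 • f ![0, 0, 1] := by
  rw [← map_smul, ← map_smul, ← map_smul, ← map_add, ← map_add]
  congr 1
  ext i
  fin_cases i <;> simp

theorem lei4_apply_zero {F : Type*} [Field F] {lam : F} {f : (Fin 3 → F) ≃ₗ[F] (Fin 3 → F)}
    (hf : f ∈ (lei4 F lam).Aut) (x : Fin 3 → F) :
    f x 0 = x 0 * f ![1, 0, 0] 0 + x 1 * f ![0, 1, 0] 0 := by
  rw [lei4_apply f x, lei4_e3 hf]
  simp

theorem lei4_apply_one {F : Type*} [Field F] {lam : F} {f : (Fin 3 → F) ≃ₗ[F] (Fin 3 → F)}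
    (hf : f ∈ (lei4 F lam).Aut) (x : Fin 3 → F) :
    f x 1 = x 0 * f ![1, 0, 0] 1 + x 1 * f ![0, 1, 0] 1 := by
  rw [lei4_apply f x, lei4_e3 hf]
  simp

/-- The induced matrix as a monoid homomorphism. -/
def lei4Hom (F : Type*) [Field F] (lam : F) :
    (lei4 F lam).Aut →* Matrix (Fin 2) (Fin 2) F where
  toFun f := lei4Mat f.1
  map_one' := by
    ext i j
    fin_cases i <;> fin_cases j <;> simp [lei4Mat]
  map_mul' := by
    rintro ⟨f, hf⟩ ⟨g, hg⟩
    have h0 := lei4_apply_zero hf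
    have h1 := lei4_apply_one hf
    ext i j
    fin_cases i <;> fin_cases j <;>
      simp only [lei4Mat, Matrix.mul_apply, Fin.sum_univ_two] <;> simp
    · rw [h0 (g ![1, 0, 0])]; ring
    · rw [h0 (g ![0, 1, 0])]; ring
    · rw [h1 (g ![1, 0, 0])]; ring
    · rw [h1 (g ![0, 1, 0])]; ring

theorem lei4_shape {F : Type*} [Field F] [CharP F 2] {lam : F} (hlam : lam ≠ 0)
    {f : (Fin 3 → F) ≃ₗ[F] (Fin 3 → F)} (hf : f ∈ (lei4 F lam).Aut) :
    f ![0, 1, 0] 0 = lam * f ![1, 0, 0] 1 ∧ f ![0, 1, 0] 1 = f ![1, 0, 0] 0 := by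
  have e3 := lei4_e3 hf
  have h12 := hf ![1, 0, 0] ![0, 1, 0]
  have h22 := hf ![0, 1, 0] ![0, 1, 0]
  rw [lei4_bracket_apply, lei4_bracket_apply] at h12 h22
  have hne : f ![0, 0, 1] ≠ 0 := by
    intro h
    have := congrFun (f.map_eq_zero_iff.1 h) 2
    simp at this
  have hv : (![0, 0, lam] : Fin 3 → F) = lam • ![0, 0, 1] := by simp
  have hz : (![0, 0, 0] : Fin 3 → F) = 0 := by ext i; fin_cases i <;> rfl
  simp [hz] at h12
  simp only [Matrix.cons_val_zero, Matrix.cons_val_one, mul_zero, mul_one, zero_add, hv,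
    map_smul, e3] at h22
  have q22 := congrFun h22 2
  have q12 := congrFun h12 2
  rw [e3] at hne
  generalize f ![1, 0, 0] 0 = p at *
  generalize f ![1, 0, 0] 1 = q at *
  generalize f ![0, 1, 0] 0 = r at *
  generalize f ![0, 1, 0] 1 = s at *
  simp at q22 q12
  have hmu : p * p + lam * (q * q) ≠ 0 := by
    intro h
    apply hne
    rw [h, hz]
  have sq : ∀ a b : F, a * a = b * b → a = b := by
    intro a b h
    exact CharTwo.sq_injective (by simpa [pow_two] using h)
  have two : (2 : F) = 0 := CharTwo.two_eq_zero
  by_cases hp : p = 0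
  · subst hp
    have hq : q ≠ 0 := by rintro rfl; simp at hmu
    have hs : s = 0 := by simpa [hlam, hq] using q12
    subst hs
    refine ⟨sq _ _ ?_, rfl⟩
    linear_combination -q22
  · have hs : s = p := by
      apply sq
      apply mul_left_cancel₀ (mul_ne_zero hlam hmu)
      linear_combination (-(p * p)) * q22 + (p * r - lam * q * s) * q12
    refine ⟨?_, hs⟩
    subst hs
    apply mul_left_cancel₀ hp
    linear_combination -q12 - lam * q * s * two

/-- The automorphism attached to a matrix of the given shape. -/
def lei4Equiv {F : Type*} [Field F] (lam a b : F) (hd : a * a - lam * (b * b) ≠ 0) :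
    (Fin 3 → F) ≃ₗ[F] (Fin 3 → F) where
  toFun x := ![a * x 0 + lam * b * x 1, b * x 0 + a * x 1, (a * a - lam * (b * b)) * x 2]
  invFun y := ![(a * a - lam * (b * b))⁻¹ * (a * y 0 - lam * b * y 1),
    (a * a - lam * (b * b))⁻¹ * (a * y 1 - b * y 0), (a * a - lam * (b * b))⁻¹ * y 2]
  map_add' x y := by
    ext i
    fin_cases i <;> simp <;> ring
  map_smul' c x := by
    ext i
    fin_cases i <;> simp <;> ring
  left_inv x := by
    ext i
    fin_cases i <;> simp only [] <;> apply mul_left_cancel₀ hd <;> simp [hd] <;> ring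
  right_inv x := by
    have h := mul_inv_cancel₀ hd
    ext i
    fin_cases i <;> simp
    · linear_combination x 0 * h
    · linear_combination x 1 * h
    · linear_combination x 2 * h

theorem lei4Equiv_mem {F : Type*} [Field F] [CharP F 2] (lam a b : F)
    (hd : a * a - lam * (b * b) ≠ 0) : lei4Equiv lam a b hd ∈ (lei4 F lam).Aut := by
  intro x y
  have two : (2 : F) = 0 := CharTwo.two_eq_zero
  rw [lei4_bracket_apply, lei4_bracket_apply]
  ext i
  fin_cases i <;> simp [lei4Equiv]
  linear_combination (-(lam * b * b * x 0 * y 0) - lam ^ 2 * b * b * x 1 * y 1 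
    - lam * a * b * (x 0 * y 1 + x 1 * y 0)) * two

/-- for `L = Lei₄(3,F)` over a field of characteristic 2 and
`G = Aut(L)`, the quotient of `G` by `C = C_G(L/ζ(L))` is isomorphic to the
subgroup of `GL₂(F)` of invertible matrices `!![α₁, λα₂; α₂, α₁]`.  This is
expressed by a homomorphism `ψ : G →* GL₂(F)` whose kernel is `C` and whose
range consists exactly of these matrices, together with the isomorphism
`G/C = G/ker ψ ≅ ψ.range`. -/
theorem lei4_aut_quotient_char_two
    (F : Type*) [Field F] [CharP F 2] (lam : F) (hlam : lam ≠ 0) :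
    ∃ ψ : (lei4 F lam).Aut →* GL (Fin 2) F,
      (∀ f : (lei4 F lam).Aut, f ∈ ψ.ker ↔
        ∀ x : Fin 3 → F,
          (f : (Fin 3 → F) ≃ₗ[F] (Fin 3 → F)) x - x ∈ (lei4 F lam).center) ∧
      (∀ M : GL (Fin 2) F, M ∈ ψ.range ↔
        ∃ α₁ α₂ : F,
          (M : Matrix (Fin 2) (Fin 2) F) = !![α₁, lam * α₂; α₂, α₁]) ∧
      Nonempty (((lei4 F lam).Aut ⧸ ψ.ker) ≃* ψ.range) := by
  refine ⟨(lei4Hom F lam).toHomUnits, ?_, ?_, ⟨QuotientGroup.quotientKerEquivRange _⟩⟩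
  · rintro ⟨f, hf⟩
    have h0 := lei4_apply_zero hf
    have h1 := lei4_apply_one hf
    rw [MonoidHom.mem_ker, Units.ext_iff]
    simp only [MonoidHom.coe_toHomUnits, Units.val_one, lei4_mem_center F lam hlam]
    change lei4Mat f = 1 ↔ _
    constructor
    · intro h x
      have h00 := congrFun (congrFun h 0) 0
      have h01 := congrFun (congrFun h 0) 1
      have h10 := congrFun (congrFun h 1) 0
      have h11 := congrFun (congrFun h 1) 1
      simp [lei4Mat] at h00 h01 h10 h11
      simp [h0 x, h1 x, h00, h01, h10, h11]
    · intro h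
      have ha := h ![1, 0, 0]
      have hb := h ![0, 1, 0]
      simp [sub_eq_zero] at ha hb
      ext i j
      fin_cases i <;> fin_cases j <;> simp [lei4Mat, ha, hb]
  · intro M
    constructor
    · rintro ⟨⟨f, hf⟩, rfl⟩
      obtain ⟨hr, hs⟩ := lei4_shape hlam hf
      refine ⟨f ![1, 0, 0] 0, f ![1, 0, 0] 1, ?_⟩
      rw [MonoidHom.coe_toHomUnits]
      change lei4Mat f = _
      rw [lei4Mat, hr, hs]
    · rintro ⟨a, b, hM⟩
      have hd : a * a - lam * (b * b) ≠ 0 := by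
        have h := ((Matrix.isUnit_iff_isUnit_det _).1 M.isUnit).ne_zero
        rw [hM, Matrix.det_fin_two_of] at h
        intro h'
        apply h
        linear_combination h'
      refine ⟨⟨lei4Equiv lam a b hd, lei4Equiv_mem lam a b hd⟩, ?_⟩
      rw [Units.ext_iff, MonoidHom.coe_toHomUnits, hM]
      change lei4Mat (lei4Equiv lam a b hd) = _
      ext i j
      fin_cases i <;> fin_cases j <;> simp [lei4Mat, lei4Equiv]
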